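/- (Fourth dissociation theorem, 'Théorème M') Let L/K be a field extension of finite degree. Then there exists a unique intermediate field M with K ≤ M ≤ L satisfying simultaneously the two properties: (1) the extension M/K is galtourable; (2) the extension L/M is either trivial (L = M) or galsimple and not Galois. -/

import Mathlib

/-- A Galois tower of the extension `L/K`: a finite increasing chain of intermediate
fields from `K` (i.e. `⊥`) to `L` (i.e. `⊤`) each of whose steps is a Galois extension. -/
def IsGaloisTower {K L : Type*} [Field K] [Field L] [Algebra K L] {m : ℕ}
    (F : Fin (m + 1) → IntermediateField K L) : Prop :=
  Monotone F ∧ F 0 = ⊥ ∧ F (Fin.last m) = ⊤ ∧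
    ∀ i : Fin m, ∀ h : F i.castSucc ≤ F i.succ,
      IsGalois (F i.castSucc) (IntermediateField.extendScalars h)

/-- An extension `L/K` is galtourable if it admits a Galois tower. -/
def Galtourable (K L : Type*) [Field K] [Field L] [Algebra K L] : Prop :=
  ∃ (m : ℕ) (F : Fin (m + 1) → IntermediateField K L), IsGaloisTower F


/-- An extension `L/K` is galsimple if it is nontrivial and admits no proper nontrivial
Galois quotient extension: `L ≠ K`, and every intermediate field `F` with `F/K` Galois
satisfies `F = K` or `F = L`. -/
def Galsimple (K L : Type*) [Field K] [Field L] [Algebra K L] : Prop :=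
  (⊥ : IntermediateField K L) ≠ ⊤ ∧
    ∀ F : IntermediateField K L, IsGalois K F → F = ⊥ ∨ F = ⊤

/-- `F` is a Galois extension of its subfield `E`, for intermediate fields `E` and `F`
of `L/K`. -/
def IsGaloisStep {K L : Type*} [Field K] [Field L] [Algebra K L]
    (E F : IntermediateField K L) : Prop :=
  ∃ h : E ≤ F, IsGalois E (IntermediateField.extendScalars h)

section GaloisStep

open IntermediateField

theorem IsGalois.adjoin_intermediateField {F M L : Type*} [Field F] [Field M] [Field L]
    [Algebra F M] [Algebra F L] [Algebra M L] [IsScalarTower F M L]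
    (B : IntermediateField F L) [IsGalois F B] [FiniteDimensional F B] :
    IsGalois M (adjoin M (B : Set L)) := by
  obtain ⟨T, hsep, hT⟩ := IsGalois.is_separable_splitting_field F B
  rw [isSplittingField_iff] at hT
  obtain ⟨hsplit, hB⟩ := hT
  have hsplit' : ((T.map (algebraMap F M)).map (algebraMap M L)).Splits := by
    rw [Polynomial.map_map, ← IsScalarTower.algebraMap_eq]
    exact Polynomial.Splits.of_algHom hsplit B.val
  have hroot : (T.map (algebraMap F M)).rootSet L = T.rootSet L := by
    simp [Set.ext_iff, Polynomial.mem_rootSet']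
  have hadjoin : adjoin M (B : Set L) = adjoin M ((T.map (algebraMap F M)).rootSet L) := by
    rw [hroot]
    apply le_antisymm
    · rw [adjoin_le_iff]
      have : B ≤ (adjoin M (T.rootSet L)).restrictScalars F := by
        rw [hB, adjoin_le_iff]
        exact subset_adjoin M _
      exact this
    · apply adjoin.mono
      rw [hB]
      exact subset_adjoin F _
  rw [hadjoin]
  have := adjoin_rootSet_isSplittingField hsplit'
  exact IsGalois.of_separable_splitting_field (p := T.map (algebraMap F M)) hsep.map

variable {K L : Type*} [Field K] [Field L] [Algebra K L]

theorem IsGaloisStep.sup_of_le [FiniteDimensional K L] {A B M : IntermediateField K L}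
    (hAB : IsGaloisStep A B) (hAM : A ≤ M) : IsGaloisStep M (M ⊔ B) := by
  obtain ⟨h, hgal⟩ := hAB
  refine ⟨le_sup_left, ?_⟩
  let : Algebra A M := (inclusion hAM).toRingHom.toAlgebra
  have : IsScalarTower A M L := .of_algebraMap_eq fun _ ↦ rfl
  have heq : extendScalars (le_sup_left : M ≤ M ⊔ B) =
      adjoin M (extendScalars h : Set L) := by
    apply restrictScalars_injective K
    rw [extendScalars_restrictScalars, restrictScalars_adjoin, adjoin_union, adjoin_self,
      coe_extendScalars, adjoin_self]
  rw [heq]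
  exact IsGalois.adjoin_intermediateField _

theorem isGaloisStep_lift_iff {M : IntermediateField K L} {A B : IntermediateField K M} :
    IsGaloisStep (lift A) (lift B) ↔ IsGaloisStep A B := by
  have hle : lift A ≤ lift B ↔ A ≤ B :=
    ⟨fun h x hx ↦ (mem_lift x).1 (h ((mem_lift x).2 hx)), fun h ↦ map_mono _ h⟩
  constructor
  · rintro ⟨h, _⟩
    exact ⟨hle.1 h, IsGalois.of_equiv_equiv (f := (liftAlgEquiv A).symm.toRingEquiv)
      (E := extendScalars h)
      (g := ((liftAlgEquiv B).symm.toRingEquiv : lift B ≃+* B)) (by ext; rfl)⟩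
  · rintro ⟨h, _⟩
    exact ⟨hle.2 h, IsGalois.of_equiv_equiv (f := (liftAlgEquiv A).toRingEquiv)
      (E := extendScalars h)
      (g := ((liftAlgEquiv B).toRingEquiv : B ≃+* lift B)) (by ext; rfl)⟩

theorem isGaloisStep_restrictScalars_iff {M : IntermediateField K L}
    {F : IntermediateField M L} :
    IsGaloisStep M (F.restrictScalars K) ↔ IsGalois M F :=
  ⟨fun ⟨_, h⟩ ↦ h, fun h ↦ ⟨fun x hx ↦ F.algebraMap_mem ⟨x, hx⟩, h⟩⟩

theorem galtourable_iff_reflTransGen :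
    Galtourable K L ↔ Relation.ReflTransGen IsGaloisStep (⊥ : IntermediateField K L) ⊤ := by
  constructor
  · rintro ⟨m, F, hmono, hbot, htop, hgal⟩
    rw [← htop]
    refine Fin.induction (by rw [hbot]) (fun i hi ↦ ?_) (Fin.last m)
    have h : F i.castSucc ≤ F i.succ := hmono i.castSucc_le_succ
    exact hi.tail ⟨h, hgal i h⟩
  · intro h
    obtain ⟨p, hhead, hlast⟩ : ∃ p : RelSeries {(E, F) : IntermediateField K L × _ |
        IsGaloisStep E F}, p.head = ⊥ ∧ p.last = ⊤ := by
      generalize (⊤ : IntermediateField K L) = N at h ⊢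
      induction h with
      | refl => exact ⟨.singleton _ _, rfl, rfl⟩
      | tail _ hstep ih =>
        obtain ⟨p, hhead, rfl⟩ := ih
        exact ⟨p.snoc _ hstep, by simpa using hhead, by simp⟩
    exact ⟨p.length, p, Fin.monotone_iff_le_succ.2 fun i ↦ (p.step i).1, hhead, hlast,
      fun i _ ↦ (p.step i).2⟩

theorem galtourable_intermediateField_iff {M : IntermediateField K L} :
    Galtourable K M ↔ Relation.ReflTransGen IsGaloisStep ⊥ M := by
  rw [galtourable_iff_reflTransGen]
  constructor
  · intro h
    simpa [Function.onFun] using h.lift lift fun _ _ ↦ isGaloisStep_lift_iff.2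
  · intro h
    suffices ∀ N : IntermediateField K L, Relation.ReflTransGen IsGaloisStep ⊥ N →
        ∀ hN : N ≤ M, Relation.ReflTransGen IsGaloisStep ⊥ (restrict hN) by
      convert this M h le_rfl
      rw [← lift_inj, lift_restrict, lift_top]
    intro N hN
    induction hN with
    | refl =>
      intro hbot
      convert Relation.ReflTransGen.refl
      rw [← lift_inj, lift_restrict, lift_bot]
    | tail _ hstep ih =>
      intro hle
      refine (ih (hstep.1.trans hle)).tail ?_
      rwa [← isGaloisStep_lift_iff, lift_restrict, lift_restrict]

theorem eq_top_or_galsimple_and_not_isGalois_iff {M : IntermediateField K L} :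
    (M = ⊤ ∨ (Galsimple M L ∧ ¬ IsGalois M L)) ↔
      ∀ N : IntermediateField K L, IsGaloisStep M N → N = M := by
  constructor
  · rintro (rfl | ⟨⟨-, hsimple⟩, hgal⟩) N ⟨hle, hN⟩
    · exact top_le_iff.1 hle
    · rcases hsimple _ hN with h | h
      · simpa using congrArg (IntermediateField.restrictScalars K) h
      · rw [h] at hN
        exact absurd (isGalois_iff_isGalois_top.1 hN) hgal
  · intro h
    refine or_iff_not_imp_left.2 fun hM ↦ ⟨⟨fun hbot ↦ hM ?_, fun F hF ↦ .inl ?_⟩, fun hgal ↦ hM ?_⟩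
    · simpa using congrArg (IntermediateField.restrictScalars K) hbot
    · apply restrictScalars_injective K
      simpa using h _ (isGaloisStep_restrictScalars_iff.2 hF)
    · have := h _ (isGaloisStep_restrictScalars_iff.2 (isGalois_iff_isGalois_top.2 hgal))
      simpa using this.symm

theorem Relation.ReflTransGen.le_of_forall_isGaloisStep_eq [FiniteDimensional K L]
    {M N : IntermediateField K L} (hN : Relation.ReflTransGen IsGaloisStep ⊥ N)
    (hM : ∀ F : IntermediateField K L, IsGaloisStep M F → F = M) : N ≤ M := by
  induction hN with
  | refl => exact bot_le
  | tail _ hstep ih => exact sup_eq_left.1 (hM _ (hstep.sup_of_le ih))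

end GaloisStep

/-- Théorème M (fourth dissociation theorem): for every finite extension `L/K` there is a
unique intermediate field `M` such that `M/K` is galtourable and `L/M` is either trivial
or galsimple and not Galois. -/
theorem theoreme_M (K L : Type*) [Field K] [Field L] [Algebra K L]
    [FiniteDimensional K L] :
    ∃! M : IntermediateField K L,
      Galtourable K M ∧ (M = ⊤ ∨ (Galsimple M L ∧ ¬ IsGalois M L)) := by
  simp only [galtourable_intermediateField_iff, eq_top_or_galsimple_and_not_isGalois_iff]
  have : WellFoundedGT (IntermediateField K L) :=
    (Subalgebra.toSubmodule.strictMono.comp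
      IntermediateField.toSubalgebra_strictMono).wellFoundedGT
  obtain ⟨M, hM⟩ := wellFounded_gt.has_min
    {M : IntermediateField K L | Relation.ReflTransGen IsGaloisStep ⊥ M} ⟨⊥, .refl⟩
  have hterminal : ∀ N : IntermediateField K L, IsGaloisStep M N → N = M := fun N hN ↦
    (hN.1.eq_of_not_lt (hM.2 N (hM.1.tail hN))).symm
  exact ⟨M, ⟨hM.1, hterminal⟩, fun N hN ↦ le_antisymm
    (hN.1.le_of_forall_isGaloisStep_eq hterminal) (hM.1.le_of_forall_isGaloisStep_eq hN.2)⟩
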